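/- (Exact SOS relaxation) Let m be even and f_0,...,f_p degree-m polynomials on ℝ^n with essentially nonpositive coefficients. Suppose the Slater condition holds: there is x_0 with f_l(x_0) < 0 for l = 1,...,p, and suppose inf{f_0(x) : f_l(x) ≤ 0, l=1,...,p} > −∞. Then min{f_0(x) : f_l(x) ≤ 0, l=1,...,p} = max{μ : f_0 + ∑_{l=1}^p λ_l f_l − μ is SOS of degree ≤ m, λ_l ≥ 0}, and the maximum is attained. -/

import Mathlib

open Finset MvPolynomial

noncomputable section

/-- Entrywise inner product of two m-th order n-dimensional tensors. -/
def tIP {m n : ℕ} (A B : (Fin m → Fin n) → ℝ) : ℝ :=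
  ∑ i : Fin m → Fin n, A i * B i

/-- The rank-one tensor `x^{⊗m}` with entries `x_{i_1} ⋯ x_{i_m}`. -/
def rk1 {n : ℕ} (m : ℕ) (x : Fin n → ℝ) : (Fin m → Fin n) → ℝ :=
  fun i => ∏ k, x (i k)

/-- A tensor is symmetric if invariant under permutations of its indices. -/
def TSymm {m n : ℕ} (A : (Fin m → Fin n) → ℝ) : Prop :=
  ∀ (σ : Equiv.Perm (Fin m)) (i : Fin m → Fin n), A (i ∘ σ) = A i

/-- Essentially nonpositive: entries with indices not all equal are ≤ 0. -/
def EssNonpos {m n : ℕ} (A : (Fin m → Fin n) → ℝ) : Prop :=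
  ∀ i : Fin m → Fin n, (¬ ∀ k l, i k = i l) → A i ≤ 0

/-- `U_{m,n}`: convex hull of the rank-one tensors `x^{⊗m}`. -/
def Ucone (m n : ℕ) : Set ((Fin m → Fin n) → ℝ) :=
  convexHull ℝ {X | ∃ x : Fin n → ℝ, X = rk1 m x}

/-- The tensor `P^m A`. -/
def pmul {m n : ℕ} (P : Matrix (Fin n) (Fin n) ℝ) (A : (Fin m → Fin n) → ℝ) :
    (Fin m → Fin n) → ℝ :=
  fun i => ∑ j : Fin m → Fin n, (∏ k, P (i k) (j k)) * A j

/-- A real-valued function on ℝⁿ is a sum of squares of polynomials. -/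
def IsSOSFun {n : ℕ} (f : (Fin n → ℝ) → ℝ) : Prop :=
  ∃ (r : ℕ) (g : Fin r → MvPolynomial (Fin n) ℝ),
    ∀ x, f x = ∑ j, (MvPolynomial.eval x (g j)) ^ 2

/-- A polynomial is a sum of squares of polynomials. -/
def IsSOSPoly {n : ℕ} (f : MvPolynomial (Fin n) ℝ) : Prop :=
  ∃ (r : ℕ) (g : Fin r → MvPolynomial (Fin n) ℝ), f = ∑ j, (g j) ^ 2

/-- A polynomial has essentially nonpositive coefficients (w.r.t. degree m):
    every coefficient except the constant term and those of `x_i^m` is ≤ 0. -/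
def EssNonposCoeff {n : ℕ} (m : ℕ) (f : MvPolynomial (Fin n) ℝ) : Prop :=
  ∀ α : Fin n →₀ ℕ, α ≠ 0 → (∀ i, α ≠ Finsupp.single i m) → f.coeff α ≤ 0

lemma IsSumSq.smul_nonneg {R : Type*} [CommRing R] [Algebra ℝ R] {a : R} (ha : IsSumSq a)
    {c : ℝ} (hc : 0 ≤ c) : IsSumSq (c • a) := by
  have h : algebraMap ℝ R c = algebraMap ℝ R (√c) * algebraMap ℝ R (√c) := by
    rw [← map_mul, Real.mul_self_sqrt hc]
  rw [Algebra.smul_def, h]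
  exact (IsSumSq.mul_self _).mul ha

lemma isSumSq_sub_mul_pow_sub {R : Type*} [CommRing R] {a b : R} (ha : IsSumSq a)
    (hb : IsSumSq b) (d : ℕ) : IsSumSq ((a - b) * (a ^ d - b ^ d)) := by
  have hpow : ∀ {x : R}, IsSumSq x → ∀ k : ℕ, IsSumSq (x ^ k) := by
    intro x hx k
    induction k with
    | zero => simp
    | succ k ih => rw [pow_succ]; exact ih.mul hx
  rw [← Commute.mul_geom_sum₂ (Commute.all a b), ← mul_assoc]
  exact (IsSumSq.mul_self _).mul
    (IsSumSq.sum fun i _ => (hpow ha _).mul (hpow hb _))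

/-- AM-GM for sums of squares. -/
lemma isSumSq_amgm {R : Type*} [CommRing R] [Algebra ℝ R] {ι : Type*} [DecidableEq ι]
    (y : ι → R) (hy : ∀ i, IsSumSq (y i)) (d : ℕ) :
    ∀ s : Finset ι, s.card = d → IsSumSq (∑ i ∈ s, y i ^ d - d * ∏ i ∈ s, y i) := by
  induction d with
  | zero => intro s hs; simp [Finset.card_eq_zero.mp hs]
  | succ d ih =>
    intro s hs
    rcases Nat.eq_zero_or_pos d with rfl | hd
    · obtain ⟨a, rfl⟩ := Finset.card_eq_one.mp hs
      simp
    have h1 : IsSumSq (∑ j ∈ s, y j * (∑ k ∈ s.erase j, y k ^ d - d * ∏ k ∈ s.erase j, y k)) :=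
      IsSumSq.sum fun j hj => (hy j).mul (ih _ (by rw [Finset.card_erase_of_mem hj, hs]; rfl))
    have h2 : IsSumSq (∑ j ∈ s, ∑ k ∈ s, (y j - y k) * (y j ^ d - y k ^ d)) :=
      IsSumSq.sum fun j _ => IsSumSq.sum fun k _ => isSumSq_sub_mul_pow_sub (hy j) (hy k) d
    have e1 : ∑ j ∈ s, y j * (∑ k ∈ s.erase j, y k ^ d - d * ∏ k ∈ s.erase j, y k)
        = (∑ j ∈ s, y j) * (∑ k ∈ s, y k ^ d) - ∑ j ∈ s, y j ^ (d + 1)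
          - (d + 1) * d * ∏ k ∈ s, y k := by
      have : ∀ j ∈ s, y j * (∑ k ∈ s.erase j, y k ^ d - d * ∏ k ∈ s.erase j, y k)
          = y j * (∑ k ∈ s, y k ^ d) - y j ^ (d + 1) - d * ∏ k ∈ s, y k := by
        intro j hj
        rw [← Finset.mul_prod_erase s y hj, ← Finset.add_sum_erase s (fun k => y k ^ d) hj]
        ring
      rw [Finset.sum_congr rfl this, Finset.sum_sub_distrib, Finset.sum_sub_distrib,
        Finset.sum_mul, Finset.sum_const, hs, nsmul_eq_mul]
      push_cast; ring
    have e2 : ∑ j ∈ s, ∑ k ∈ s, (y j - y k) * (y j ^ d - y k ^ d)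
        = 2 * ((d + 1) * ∑ j ∈ s, y j ^ (d + 1) - (∑ j ∈ s, y j) * (∑ k ∈ s, y k ^ d)) := by
      have : ∀ j ∈ s, ∑ k ∈ s, (y j - y k) * (y j ^ d - y k ^ d)
          = (d + 1) * y j ^ (d + 1) + ∑ k ∈ s, y k ^ (d + 1)
            - y j * (∑ k ∈ s, y k ^ d) - y j ^ d * ∑ k ∈ s, y k := by
        intro j hj
        have h3 : ((d : R) + 1) * y j ^ (d + 1) = ∑ k ∈ s, y j ^ (d + 1) := by
          rw [Finset.sum_const, hs, nsmul_eq_mul]; push_cast; ring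
        rw [h3, Finset.mul_sum, Finset.mul_sum, ← Finset.sum_add_distrib,
          ← Finset.sum_sub_distrib, ← Finset.sum_sub_distrib]
        exact Finset.sum_congr rfl fun k _ => by ring
      rw [Finset.sum_congr rfl this, Finset.sum_sub_distrib, Finset.sum_sub_distrib,
        Finset.sum_add_distrib, ← Finset.sum_mul, ← Finset.sum_mul, ← Finset.mul_sum,
        Finset.sum_const, hs, nsmul_eq_mul]
      push_cast; ring
    have hd' : (d : ℝ) ≠ 0 := by positivity
    have h3 := (h1.add (h2.smul_nonneg (c := 1 / 2) (by norm_num))).smul_nonneg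
      (c := (d : ℝ)⁻¹) (by positivity)
    rw [e1, e2] at h3
    convert h3 using 1
    have two : ∀ a : R, (1 / 2 : ℝ) • (2 * a) = a := by
      intro a; rw [two_mul, ← two_smul ℝ a, smul_smul]; norm_num
    rw [two]
    have hfin : ∀ a : R, (d : ℝ)⁻¹ • ((d : R) * a) = a := by
      intro a
      rw [← nsmul_eq_mul, ← Nat.cast_smul_eq_nsmul ℝ, smul_smul, inv_mul_cancel₀ hd', one_smul]
    rw [← hfin (∑ i ∈ s, y i ^ (d + 1) - _)]
    congr 1
    push_cast; ring

/-- Hurwitz: the AM-GM form of even degree is a sum of squares. -/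
lemma isSumSq_hurwitz {R : Type*} [CommRing R] [Algebra ℝ R] {ι : Type*} [Fintype ι]
    (x : ι → R) {m : ℕ} (hm : Even m) (hcard : Fintype.card ι = m) :
    IsSumSq (∑ i, x i ^ m - m * ∏ i, x i) := by
  classical
  obtain ⟨d, rfl⟩ := hm
  obtain ⟨s, -, hs⟩ := Finset.exists_subset_card_eq (s := (univ : Finset ι)) (n := d)
    (by rw [Finset.card_univ]; omega)
  have hs' : sᶜ.card = d := by rw [Finset.card_compl]; omega
  have hy : ∀ i, IsSumSq (x i * x i) := fun i => IsSumSq.mul_self _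
  have h := ((isSumSq_amgm _ hy d s hs).add (isSumSq_amgm _ hy d sᶜ hs')).add
    ((IsSumSq.mul_self (∏ i ∈ s, x i - ∏ i ∈ sᶜ, x i)).smul_nonneg (c := d) (by positivity))
  refine Eq.subst (motive := IsSumSq) ?_ h
  rw [← Finset.prod_mul_prod_compl s x, ← Finset.sum_add_sum_compl s (fun i => x i ^ (d + d)),
    Nat.cast_smul_eq_nsmul, nsmul_eq_mul, Finset.prod_mul_distrib, Finset.prod_mul_distrib]
  simp only [mul_pow, ← pow_add]
  push_cast; ring

lemma isSumSq_hurwitz_weighted {R : Type*} [CommRing R] [Algebra ℝ R] {κ : Type*} [Fintype κ]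
    (x : κ → R) {m : ℕ} (hm : Even m) (w : κ → ℕ) (hw : ∑ i, w i = m) :
    IsSumSq (∑ i, w i * x i ^ m - m * ∏ i, x i ^ w i) := by
  have h := isSumSq_hurwitz (ι := Σ i, Fin (w i)) (fun k => x k.1) hm (by simp [hw])
  simpa [Fintype.sum_sigma, Fintype.prod_sigma] using h

/-- The weighted AM-GM inequality with natural weights. -/
lemma amgm_nat {κ : Type*} [Fintype κ]
    (x : κ → ℝ) {m : ℕ} (hm : Even m) (w : κ → ℕ) (hw : ∑ i, w i = m) :
    m * ∏ i, x i ^ w i ≤ ∑ i, w i * x i ^ m :=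
  sub_nonneg.mp (isSumSq_hurwitz_weighted x hm w hw).nonneg

/-- The real `m`-th root. -/
def nthRoot (m : ℕ) (y : ℝ) : ℝ := y ^ ((m : ℝ)⁻¹)

lemma nthRoot_nonneg (m : ℕ) {y : ℝ} (hy : 0 ≤ y) : 0 ≤ nthRoot m y := Real.rpow_nonneg hy _

lemma nthRoot_pos (m : ℕ) {y : ℝ} (hy : 0 < y) : 0 < nthRoot m y := Real.rpow_pos_of_pos hy _

lemma nthRoot_pow {m : ℕ} (hm : m ≠ 0) {y : ℝ} (hy : 0 ≤ y) : nthRoot m y ^ m = y :=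
  Real.rpow_inv_natCast_pow hy hm

lemma nthRoot_pow' {m : ℕ} (hm : m ≠ 0) {y : ℝ} (hy : 0 ≤ y) : nthRoot m (y ^ m) = y :=
  Real.pow_rpow_inv_natCast hy hm

lemma nthRoot_one (m : ℕ) : nthRoot m 1 = 1 := Real.one_rpow _

lemma nthRoot_zero {m : ℕ} (hm : m ≠ 0) : nthRoot m 0 = 0 :=
  Real.zero_rpow (by positivity)

lemma nthRoot_mul (m : ℕ) {x y : ℝ} (hx : 0 ≤ x) (hy : 0 ≤ y) :
    nthRoot m (x * y) = nthRoot m x * nthRoot m y := Real.mul_rpow hx hy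

lemma nthRoot_div (m : ℕ) {x y : ℝ} (hx : 0 ≤ x) (hy : 0 ≤ y) :
    nthRoot m (x / y) = nthRoot m x / nthRoot m y := Real.div_rpow hx hy _

lemma continuous_nthRoot (m : ℕ) : Continuous (nthRoot m) :=
  Real.continuous_rpow_const (by positivity)

/-- The weighted geometric mean `∏ uᵢ ^ (wᵢ / m)`. -/
def geomMean {κ : Type*} [Fintype κ] (m : ℕ) (w : κ → ℕ) (u : κ → ℝ) : ℝ :=
  ∏ i, nthRoot m (u i) ^ w i

lemma continuous_geomMean {κ : Type*} [Fintype κ] (m : ℕ) (w : κ → ℕ) :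
    Continuous (geomMean m w) :=
  continuous_finsetProd _ fun i _ => ((continuous_nthRoot m).comp (continuous_apply i)).pow _

lemma geomMean_concave {κ : Type*} [Fintype κ] {m : ℕ} (hm : Even m) (hm0 : m ≠ 0)
    (w : κ → ℕ) (hw : ∑ i, w i = m) {u v : κ → ℝ} (hu : ∀ i, 0 ≤ u i) (hv : ∀ i, 0 ≤ v i)
    {a b : ℝ} (ha : 0 ≤ a) (hb : 0 ≤ b) :
    a * geomMean m w u + b * geomMean m w v ≤ geomMean m w (a • u + b • v) := by
  have hz : ∀ i, 0 ≤ (a • u + b • v) i := fun i =>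
    add_nonneg (mul_nonneg ha (hu i)) (mul_nonneg hb (hv i))
  have hG : 0 ≤ geomMean m w (a • u + b • v) :=
    Finset.prod_nonneg fun i _ => pow_nonneg (nthRoot_nonneg m (hz i)) _
  by_cases h0 : ∃ i, w i ≠ 0 ∧ (a • u + b • v) i = 0
  · obtain ⟨i, hwi, hi⟩ := h0
    have hvan : ∀ (t : κ → ℝ) (r : ℝ), r * t i = 0 → r * geomMean m w t = 0 := by
      intro t r h
      rcases mul_eq_zero.mp h with h | h
      · simp [h]
      · rw [geomMean, Finset.prod_eq_zero (Finset.mem_univ i), mul_zero]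
        rw [h, nthRoot_zero hm0, zero_pow hwi]
    have h1 := mul_nonneg ha (hu i)
    have h2 := mul_nonneg hb (hv i)
    have h3 : a * u i + b * v i = 0 := hi
    rw [hvan u a (by linarith), hvan v b (by linarith), add_zero]
    exact hG
  · push Not at h0
    set z := a • u + b • v with hzdef
    have hzr : ∀ i, w i ≠ 0 → nthRoot m (z i) ≠ 0 := fun i hi =>
      (nthRoot_pos m (lt_of_le_of_ne (hz i) (h0 i hi).symm)).ne'
    have hGne : geomMean m w z ≠ 0 := Finset.prod_ne_zero_iff.mpr fun i _ => by
      by_cases hi : w i = 0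
      · simp [hi]
      · exact pow_ne_zero _ (hzr i hi)
    have key : ∀ t : κ → ℝ, (∀ i, 0 ≤ t i) →
        m * (geomMean m w t / geomMean m w z) ≤ ∑ i, w i * (t i / z i) := by
      intro t ht
      have h := amgm_nat (fun i => nthRoot m (t i) / nthRoot m (z i)) hm w hw
      simp only [div_pow, Finset.prod_div_distrib, nthRoot_pow hm0 (ht _),
        nthRoot_pow hm0 (hz _)] at h
      exact h
    have hsum : a * ∑ i, w i * (u i / z i) + b * ∑ i, w i * (v i / z i) = m := by
      rw [Finset.mul_sum, Finset.mul_sum, ← Finset.sum_add_distrib, ← hw]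
      push_cast
      refine Finset.sum_congr rfl fun i _ => ?_
      by_cases hi : w i = 0
      · simp [hi]
      · have h1 : z i = a * u i + b * v i := rfl
        have h2 := h0 i hi
        field_simp
        rw [h1]
    have hmR : (0 : ℝ) < m := by positivity
    have hGpos := lt_of_le_of_ne hG hGne.symm
    have h1 := mul_le_mul_of_nonneg_left (key u hu) ha
    have h2 := mul_le_mul_of_nonneg_left (key v hv) hb
    have h3 : m * ((a * geomMean m w u + b * geomMean m w v) / geomMean m w z) ≤ m * 1 := by
      calc _ = a * (m * (geomMean m w u / geomMean m w z))
            + b * (m * (geomMean m w v / geomMean m w z)) := by ring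
        _ ≤ _ := by linarith
    exact (div_le_one hGpos).mp (le_of_mul_le_mul_left h3 hmR)

/-- Nonnegative forms `∑ bᵢ xᵢ ^ m - ∑ cₐ x ^ wₐ` split into AM-GM forms, one for each `a`. -/
lemma exists_diag_split {κ A : Type*} [Fintype κ] [Fintype A] {m : ℕ} (hm : Even m)
    (hm0 : m ≠ 0) (w : A → κ → ℕ) (hw : ∀ a, ∑ i, w a i = m) (c : A → ℝ) (hc : ∀ a, 0 ≤ c a)
    (b : κ → ℝ) (hpos : ∀ x : κ → ℝ, (∀ i, 0 < x i) →
      ∑ a, c a * ∏ i, x i ^ w a i ≤ ∑ i, b i * x i ^ m) :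
    ∃ s : A → κ → ℝ, (∀ a i, 0 ≤ s a i) ∧
      (∀ a, c a * geomMean m (w a) (fun i => (w a i : ℝ) / m) ≤ geomMean m (w a) (s a)) ∧
      ∀ i, ∑ a, s a i ≤ b i := by
  classical
  set C : A → ℝ := fun a => c a * geomMean m (w a) (fun i => (w a i : ℝ) / m) with hC
  set K : Set (κ → ℝ) := {b | ∃ s : A → κ → ℝ, (∀ a i, 0 ≤ s a i) ∧
    (∀ a, C a ≤ geomMean m (w a) (s a)) ∧ ∀ i, ∑ a, s a i ≤ b i} with hK
  have hmpos : (0 : ℝ) < m := by positivity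
  have hconv : Convex ℝ K := by
    rintro b₁ ⟨s₁, h₁, g₁, l₁⟩ b₂ ⟨s₂, h₂, g₂, l₂⟩ p q hp hq hpq
    refine ⟨p • s₁ + q • s₂, fun a i => ?_, fun a => ?_, fun i => ?_⟩
    · exact add_nonneg (mul_nonneg hp (h₁ a i)) (mul_nonneg hq (h₂ a i))
    · refine le_trans ?_ (geomMean_concave hm hm0 (w a) (hw a) (h₁ a) (h₂ a) hp hq)
      calc C a = p * C a + q * C a := by rw [← add_mul, hpq, one_mul]
        _ ≤ _ := add_le_add (mul_le_mul_of_nonneg_left (g₁ a) hp)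
          (mul_le_mul_of_nonneg_left (g₂ a) hq)
    · simp only [Pi.add_apply, Pi.smul_apply, smul_eq_mul, Finset.sum_add_distrib,
        ← Finset.mul_sum]
      exact add_le_add (mul_le_mul_of_nonneg_left (l₁ i) hp)
          (mul_le_mul_of_nonneg_left (l₂ i) hq)
  have hclosed : IsClosed K := by
    refine isClosed_of_closure_subset fun b₀ hb₀ => ?_
    set U : Set (κ → ℝ) := Set.univ.pi fun i => Set.Iio (b₀ i + 1) with hU
    have hUo : IsOpen U := isOpen_set_pi Set.finite_univ fun i _ => isOpen_Iio
    have hbU : b₀ ∈ U := fun i _ => by simp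
    set D : Set ((κ → ℝ) × (A → κ → ℝ)) :=
      Set.Icc (0, 0) (fun i => b₀ i + 1, fun _ i => b₀ i + 1) ∩
        {q | (∀ a, C a ≤ geomMean m (w a) (q.2 a)) ∧ ∀ i, ∑ a, q.2 a i ≤ q.1 i} with hD
    have hDc : IsCompact D := by
      refine isCompact_Icc.inter_right ?_
      rw [Set.ofPred_and, Set.ofPred_forall, Set.ofPred_forall]
      refine (isClosed_iInter fun a => ?_).inter (isClosed_iInter fun i => ?_)
      · exact isClosed_le continuous_const
          ((continuous_geomMean m (w a)).comp ((continuous_apply a).comp continuous_snd))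
      · exact isClosed_le (by fun_prop) (by fun_prop)
    have hsub : U ∩ K ⊆ Prod.fst '' D := by
      rintro b₁ ⟨hb₁, s, hs, hg, hl⟩
      have hsb : ∀ a i, s a i ≤ b₁ i := fun a i =>
        le_trans (Finset.single_le_sum (f := fun a => s a i) (fun a _ => hs a i)
          (Finset.mem_univ a)) (hl i)
      have hb0 : ∀ i, 0 ≤ b₁ i := fun i =>
        le_trans (Finset.sum_nonneg fun a _ => hs a i) (hl i)
      have hb1 : ∀ i, b₁ i ≤ b₀ i + 1 := fun i => (hb₁ i trivial).le
      exact ⟨(b₁, s), ⟨⟨⟨hb0, hs⟩, ⟨hb1, fun a i => (hsb a i).trans (hb1 i)⟩⟩, hg, hl⟩, rfl⟩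
    have hmem : b₀ ∈ closure (U ∩ K) := hUo.inter_closure ⟨hbU, hb₀⟩
    have := closure_minimal hsub (hDc.image continuous_fst).isClosed hmem
    obtain ⟨⟨b₁, s⟩, ⟨⟨⟨-, hs⟩, -⟩, hg, hl⟩, rfl⟩ := this
    exact ⟨s, hs, hg, hl⟩
  have htest : ∀ x : κ → ℝ, (∀ i, 0 < x i) → ∃ b' ∈ K, ∑ i, b' i * x i ^ m
      = ∑ a, c a * ∏ i, x i ^ w a i := by
    intro x hx
    set q : A → ℝ := fun a => c a * ∏ i, x i ^ w a i with hq
    have hq0 : ∀ a, 0 ≤ q a := fun a =>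
      mul_nonneg (hc a) (Finset.prod_nonneg fun i _ => (pow_pos (hx i) _).le)
    refine ⟨fun i => ∑ a, (w a i : ℝ) / m * q a / x i ^ m,
      ⟨fun a i => (w a i : ℝ) / m * q a / x i ^ m, fun a i => ?_, fun a => ?_, fun i => le_rfl⟩, ?_⟩
    · have := hq0 a
      have := hx i
      positivity
    · have hx' : ∏ i, x i ^ w a i ≠ 0 :=
        Finset.prod_ne_zero_iff.mpr fun i _ => (pow_pos (hx i) _).ne'
      have : geomMean m (w a) (fun i => (w a i : ℝ) / m * q a / x i ^ m)
          = geomMean m (w a) (fun i => (w a i : ℝ) / m) * q a / ∏ i, x i ^ w a i := by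
        simp only [geomMean]
        have h1 : ∀ i, nthRoot m ((w a i : ℝ) / m * q a / x i ^ m) ^ w a i
            = nthRoot m ((w a i : ℝ) / m) ^ w a i * nthRoot m (q a) ^ w a i / x i ^ w a i := by
          intro i
          rw [nthRoot_div m (mul_nonneg (by positivity) (hq0 a)) (pow_pos (hx i) _).le,
            nthRoot_mul m (by positivity) (hq0 a), nthRoot_pow' hm0 (hx i).le, div_pow, mul_pow]
        simp only [h1, Finset.prod_div_distrib, Finset.prod_mul_distrib]
        rw [Finset.prod_pow_eq_pow_sum, hw, nthRoot_pow hm0 (hq0 a)]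
      rw [this, hC, hq]
      apply le_of_eq
      field_simp
    · have h1 : ∀ i, (∑ a, (w a i : ℝ) / m * q a / x i ^ m) * x i ^ m
          = ∑ a, (w a i : ℝ) / m * q a := by
        intro i
        rw [Finset.sum_mul]
        exact Finset.sum_congr rfl fun a _ => div_mul_cancel₀ _ (pow_pos (hx i) _).ne'
      rw [Finset.sum_congr rfl fun i _ => h1 i, Finset.sum_comm]
      refine Finset.sum_congr rfl fun a _ => ?_
      rw [← Finset.sum_mul, ← Finset.sum_div, ← Nat.cast_sum, hw, div_self hmpos.ne', one_mul]
  by_contra hb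
  obtain ⟨φ, r, hφb, hφK⟩ := geometric_hahn_banach_point_closed hconv hclosed (x := b) hb
  set y : κ → ℝ := fun i => φ (Pi.single i 1) with hy
  have hφ : ∀ v : κ → ℝ, φ v = ∑ i, v i * y i := by
    intro v
    conv_lhs => rw [← Finset.univ_sum_single v]
    rw [map_sum]
    refine Finset.sum_congr rfl fun i _ => ?_
    rw [hy, ← smul_eq_mul, ← map_smul, ← Pi.single_smul, smul_eq_mul, mul_one]
  obtain ⟨b₁, ⟨s₁, h₁, g₁, l₁⟩, -⟩ := htest (fun _ => 1) (fun _ => one_pos)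
  have hy0 : ∀ i, 0 ≤ y i := by
    intro i
    by_contra! hneg
    obtain ⟨k, hk⟩ := exists_nat_gt ((φ b₁ - r) / (- y i))
    rw [div_lt_iff₀ (by linarith)] at hk
    have : b₁ + (k : ℝ) • Pi.single i (1 : ℝ) ∈ K := by
      refine ⟨s₁, h₁, g₁, fun j => (l₁ j).trans ?_⟩
      have : (0 : ℝ) ≤ (k : ℝ) * (Pi.single i (1 : ℝ) : κ → ℝ) j :=
        mul_nonneg k.cast_nonneg (by by_cases h : j = i <;> simp [h])
      simpa using this
    have := hφK _ this
    rw [map_add, map_smul, smul_eq_mul] at this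
    change r < φ b₁ + k * y i at this
    linarith
  obtain ⟨ε, hε, hεb⟩ : ∃ ε : ℝ, 0 < ε ∧ φ b + ε * ∑ i, b i < r := by
    have hden : 0 < |∑ i, b i| + 1 := by positivity
    refine ⟨(r - φ b) / (|∑ i, b i| + 1), div_pos (by linarith) hden, ?_⟩
    have : (r - φ b) / (|∑ i, b i| + 1) * ∑ i, b i < r - φ b := by
      rw [div_mul_eq_mul_div, div_lt_iff₀ hden]
      exact mul_lt_mul_of_pos_left ((le_abs_self _).trans_lt (by linarith)) (by linarith)
    linarith
  have hyε : ∀ i, 0 < y i + ε := fun i => by linarith [hy0 i]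
  obtain ⟨b', hb'K, hb'⟩ := htest (fun i => nthRoot m (y i + ε)) fun i => nthRoot_pos m (hyε i)
  have h1 := hpos (fun i => nthRoot m (y i + ε)) fun i => nthRoot_pos m (hyε i)
  rw [← hb'] at h1
  simp only [nthRoot_pow hm0 (hyε _).le, mul_add, Finset.sum_add_distrib, ← Finset.sum_mul,
    ← hφ] at h1
  have hb'0 : 0 ≤ ∑ i, b' i := by
    obtain ⟨s, hs, -, hl⟩ := hb'K
    exact Finset.sum_nonneg fun i _ => (Finset.sum_nonneg fun a _ => hs a i).trans (hl i)
  have := hφK b' hb'K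
  nlinarith [mul_nonneg hb'0 hε.le]

/-- A nonnegative diagonal-minus-tail form becomes a sum of squares in any real algebra. -/
lemma isSumSq_diag_sub_tail {R : Type*} [CommRing R] [Algebra ℝ R]
    {κ A : Type*} [Fintype κ] [Fintype A] {m : ℕ} (hm : Even m)
    (hm0 : m ≠ 0) (w : A → κ → ℕ) (hw : ∀ a, ∑ i, w a i = m) (c : A → ℝ) (hc : ∀ a, 0 ≤ c a)
    (b : κ → ℝ) (hpos : ∀ x : κ → ℝ, (∀ i, 0 < x i) →
      ∑ a, c a * ∏ i, x i ^ w a i ≤ ∑ i, b i * x i ^ m) (Y : κ → R) :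
    IsSumSq (∑ i, b i • Y i ^ m - ∑ a, c a • ∏ i, Y i ^ w a i) := by
  obtain ⟨s, hs, hg, hl⟩ := exists_diag_split hm hm0 w hw c hc b hpos
  have hmpos : (0 : ℝ) < m := by positivity
  have hYm : ∀ i, IsSumSq (Y i ^ m) := fun i => by
    obtain ⟨d, rfl⟩ := hm
    rw [pow_add]
    exact IsSumSq.mul_self _
  have hdiag : IsSumSq (∑ i, (b i - ∑ a, s a i) • Y i ^ m) :=
    IsSumSq.sum fun i _ => (hYm i).smul_nonneg (sub_nonneg.mpr (hl i))
  have hterm : ∀ a, IsSumSq (∑ i, s a i • Y i ^ m - c a • ∏ i, Y i ^ w a i) := by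
    intro a
    set t : κ → ℝ := fun i => s a i / ((w a i : ℝ) / m) with ht
    have ht0 : ∀ i, 0 ≤ t i := fun i => div_nonneg (hs a i) (by positivity)
    set q := geomMean m (w a) t with hq
    have hq0 : 0 ≤ q := Finset.prod_nonneg fun i _ => pow_nonneg (nthRoot_nonneg m (ht0 i)) _
    have hden : 0 < geomMean m (w a) (fun i => (w a i : ℝ) / m) := by
      refine Finset.prod_pos fun i _ => ?_
      rcases Nat.eq_zero_or_pos (w a i) with h | h
      · simp [h]
      · exact pow_pos (nthRoot_pos m (by positivity)) _
    have hqeq : q = geomMean m (w a) (s a) / geomMean m (w a) (fun i => (w a i : ℝ) / m) := by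
      simp only [hq, geomMean, ht, nthRoot_div m (hs a _) (by positivity : 0 ≤ (w a _ : ℝ) / m),
        div_pow, Finset.prod_div_distrib]
    have hcq : c a ≤ q := by
      rw [hqeq, le_div_iff₀ hden]; exact hg a
    have hh := (isSumSq_hurwitz_weighted (fun i => nthRoot m (t i) • Y i) hm (w a)
      (hw a)).smul_nonneg (c := (m : ℝ)⁻¹) (by positivity)
    have hr0 : 0 ≤ c a / q := div_nonneg (hc a) hq0
    have hr1 : c a / q ≤ 1 := div_le_one_of_le₀ hcq hq0
    have hrq : c a / q * q = c a := by
      rcases eq_or_ne q 0 with h | h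
      · rw [h] at hcq ⊢
        rw [mul_zero]; exact le_antisymm (hc a) hcq
      · exact div_mul_cancel₀ _ h
    have hexp : (m : ℝ)⁻¹ • (∑ i, (w a i : R) * (nthRoot m (t i) • Y i) ^ m
        - (m : R) * ∏ i, (nthRoot m (t i) • Y i) ^ w a i)
        = ∑ i, (if w a i = 0 then 0 else s a i) • Y i ^ m - q • ∏ i, Y i ^ w a i := by
      rw [smul_sub, Finset.smul_sum]
      congr 1
      · refine Finset.sum_congr rfl fun i _ => ?_
        rw [smul_pow, nthRoot_pow hm0 (ht0 i), ← nsmul_eq_mul, ← Nat.cast_smul_eq_nsmul ℝ,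
          smul_smul, smul_smul]
        congr 1
        split_ifs with h
        · simp [h]
        · have : (w a i : ℝ) ≠ 0 := by exact_mod_cast h
          simp only [ht]
          field_simp
      · simp only [Algebra.smul_def, mul_pow, Finset.prod_mul_distrib, hq, geomMean, map_prod,
          map_pow]
        rw [← mul_assoc, ← map_natCast (algebraMap ℝ R) m, ← map_mul, inv_mul_cancel₀ hmpos.ne',
          map_one, one_mul]
    rw [hexp] at hh
    have h1 : IsSumSq (∑ i, (s a i - c a / q * (if w a i = 0 then 0 else s a i)) • Y i ^ m) := by
      refine IsSumSq.sum fun i _ => (hYm i).smul_nonneg ?_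
      have := hs a i
      split_ifs
      · simpa
      · nlinarith
    have h2 := h1.add (hh.smul_nonneg hr0)
    refine Eq.subst (motive := IsSumSq) ?_ h2
    rw [smul_sub, smul_smul, hrq, Finset.smul_sum]
    simp only [sub_smul, smul_smul, Finset.sum_sub_distrib]
    abel
  have h := hdiag.add (IsSumSq.sum (I := univ) fun a _ => hterm a)
  refine Eq.subst (motive := IsSumSq) ?_ h
  simp only [sub_smul, Finset.sum_sub_distrib, Finset.sum_smul]
  rw [Finset.sum_comm]
  abel

lemma IsSumSq.isSOSPoly {n : ℕ} {f : MvPolynomial (Fin n) ℝ} (hf : IsSumSq f) : IsSOSPoly f := by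
  induction hf with
  | zero => exact ⟨0, Fin.elim0, by simp⟩
  | sq_add a _ ih =>
    obtain ⟨r, g, rfl⟩ := ih
    exact ⟨r + 1, Fin.cons a g, by simp [Fin.sum_univ_succ, sq]⟩

/-- Extension of a point of `Sⁿ` by the homogenizing coordinate `1`. -/
def homCoord {n : ℕ} {S : Type*} [One S] (x : Fin n → S) : Option (Fin n) → S :=
  fun o => o.elim 1 x

lemma EssNonposCoeff.exists_eq_diag_sub_tail {n m : ℕ} (hm0 : m ≠ 0)
    {h : MvPolynomial (Fin n) ℝ} (hdeg : h.totalDegree ≤ m) (hcoeff : EssNonposCoeff m h) :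
    ∃ (A : Type) (_ : Fintype A) (w : A → Option (Fin n) → ℕ) (c : A → ℝ)
      (b : Option (Fin n) → ℝ), (∀ a, ∑ i, w a i = m) ∧ (∀ a, 0 ≤ c a) ∧
      h = ∑ i, b i • homCoord X i ^ m - ∑ a, c a • ∏ i, homCoord X i ^ w a i := by
  classical
  set T := h.support.filter fun α => α ≠ 0 ∧ ∀ i, α ≠ Finsupp.single i m with hT
  refine ⟨T, inferInstance, fun a o => o.elim (m - ∑ i, a.1 i) a.1, fun a => - h.coeff a.1,
    fun o => o.elim (h.coeff 0) fun i => h.coeff (Finsupp.single i m), fun a => ?_, fun a => ?_, ?_⟩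
  · have h1 : ∑ i, a.1 i ≤ m := by
      have := le_totalDegree (Finset.mem_filter.mp a.2).1
      rw [Finsupp.sum_fintype _ _ fun _ => rfl] at this
      exact this.trans hdeg
    rw [Fintype.sum_option]
    exact Nat.sub_add_cancel h1
  · have := (Finset.mem_filter.mp a.2).2
    linarith [hcoeff a.1 this.1 this.2]
  · have hmon : ∀ α : Fin n →₀ ℕ, ∏ i, (X i : MvPolynomial (Fin n) ℝ) ^ α i = monomial α 1 := by
      intro α
      rw [monomial_eq, C_1, one_mul, Finsupp.prod_fintype _ _ fun _ => pow_zero _]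
    simp only [Fintype.sum_option, Fintype.prod_option, homCoord, Option.elim, one_pow, one_mul,
      hmon]
    simp only [X_pow_eq_monomial, smul_monomial, smul_eq_mul, mul_one]
    rw [Finset.sum_coe_sort T fun α => monomial α (- h.coeff α)]
    ext d
    simp only [coeff_sub, coeff_add, coeff_sum, coeff_smul, coeff_monomial, coeff_one,
      smul_eq_mul, Finset.sum_ite_eq', hT, Finset.mem_filter, mem_support_iff]
    have hs0 : ∀ i : Fin n, (Finsupp.single i m : Fin n →₀ ℕ) ≠ 0 := fun i => by simpa using hm0
    by_cases hd0 : d = 0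
    · subst hd0
      simp [hm0]
    by_cases hds : ∃ i, d = Finsupp.single i m
    · obtain ⟨i, rfl⟩ := hds
      have : ∀ j, (Finsupp.single j m = (Finsupp.single i m : Fin n →₀ ℕ)) ↔ j = i := fun j =>
        ⟨fun h => Finsupp.single_left_injective hm0 h, fun h => by rw [h]⟩
      have hnot : ¬ ∀ j, (Finsupp.single i m : Fin n →₀ ℕ) ≠ Finsupp.single j m := fun h => h i rfl
      simp only [this, (hs0 i).symm, hnot, and_false, if_false, Finset.sum_ite_eq',
        Finset.mem_univ, if_true]
      simp
    · push Not at hds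
      have : ∀ j, (Finsupp.single j m : Fin n →₀ ℕ) ≠ d := fun j => (hds j).symm
      by_cases hc : h.coeff d = 0 <;> simp [this, Ne.symm hd0, hd0, hds, hc]

lemma eval_diag_sub_tail {n m : ℕ} {A : Type*} [Fintype A] (w : A → Option (Fin n) → ℕ)
    (c : A → ℝ) (b : Option (Fin n) → ℝ) (x : Fin n → ℝ) :
    eval x (∑ i, b i • homCoord X i ^ m - ∑ a, c a • ∏ i, homCoord X i ^ w a i)
      = ∑ i, b i * homCoord x i ^ m - ∑ a, c a * ∏ i, homCoord x i ^ w a i := by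
  have : ∀ i, eval x (homCoord X i) = homCoord x i := by
    rintro (_ | i) <;> simp [homCoord]
  simp [smul_eval, this]

/-- A polynomial with essentially nonpositive coefficients which is nonnegative on the positive
orthant is a sum of squares. -/
lemma EssNonposCoeff.isSumSq {n m : ℕ} (hm : Even m) (hm0 : m ≠ 0)
    {h : MvPolynomial (Fin n) ℝ} (hdeg : h.totalDegree ≤ m) (hcoeff : EssNonposCoeff m h)
    (hpos : ∀ x : Fin n → ℝ, (∀ i, 0 < x i) → 0 ≤ eval x h) : IsSumSq h := by
  obtain ⟨A, _, w, c, b, hw, hc, rfl⟩ := hcoeff.exists_eq_diag_sub_tail hm0 hdeg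
  refine isSumSq_diag_sub_tail hm hm0 w hw c hc b (fun x hx => ?_) _
  have h1 := hpos (fun i => x (some i) / x none) fun i => div_pos (hx _) (hx _)
  rw [eval_diag_sub_tail] at h1
  have h2 : homCoord (fun i => x (some i) / x none) = fun o => x o / x none := by
    ext (_ | i)
    · exact (div_self (hx none).ne').symm
    · rfl
  have h0 : 0 < x none ^ m := pow_pos (hx none) m
  simp only [h2, div_pow, Finset.prod_div_distrib, Finset.prod_pow_eq_pow_sum, hw,
    ← mul_div_assoc, ← Finset.sum_div] at h1
  rw [← sub_div] at h1
  have := mul_nonneg h1 h0.le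
  rw [div_mul_cancel₀ _ h0.ne'] at this
  linarith

lemma EssNonposCoeff.eval_abs_le {n m : ℕ} (hm : Even m) (hm0 : m ≠ 0)
    {h : MvPolynomial (Fin n) ℝ} (hdeg : h.totalDegree ≤ m) (hcoeff : EssNonposCoeff m h)
    (x : Fin n → ℝ) : eval (fun i => |x i|) h ≤ eval x h := by
  obtain ⟨A, _, w, c, b, hw, hc, rfl⟩ := hcoeff.exists_eq_diag_sub_tail hm0 hdeg
  rw [eval_diag_sub_tail, eval_diag_sub_tail]
  have h2 : homCoord (fun i => |x i|) = fun o => |homCoord x o| := by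
    ext (_ | i) <;> simp [homCoord]
  simp only [h2, hm.pow_abs, ← abs_pow, ← Finset.abs_prod]
  refine sub_le_sub_left (Finset.sum_le_sum fun a _ => ?_) _
  exact mul_le_mul_of_nonneg_left (le_abs_self _) (hc a)

/-- Hidden convexity: the substitution `yᵢ = xᵢ ^ m` makes the polynomial convex. -/
lemma EssNonposCoeff.eval_nthRoot_convex {n m : ℕ} (hm : Even m) (hm0 : m ≠ 0)
    {h : MvPolynomial (Fin n) ℝ} (hdeg : h.totalDegree ≤ m) (hcoeff : EssNonposCoeff m h)
    {y z : Fin n → ℝ} (hy : ∀ i, 0 ≤ y i) (hz : ∀ i, 0 ≤ z i) {p q : ℝ} (hp : 0 ≤ p)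
    (hq : 0 ≤ q) (hpq : p + q = 1) :
    eval (fun i => nthRoot m ((p • y + q • z) i)) h
      ≤ p * eval (fun i => nthRoot m (y i)) h + q * eval (fun i => nthRoot m (z i)) h := by
  obtain ⟨A, _, w, c, b, hw, hc, rfl⟩ := hcoeff.exists_eq_diag_sub_tail hm0 hdeg
  have hr : ∀ u : Fin n → ℝ, homCoord (fun i => nthRoot m (u i))
      = fun o => nthRoot m (homCoord u o) := by
    intro u; ext (_ | i) <;> simp [homCoord, nthRoot_one]
  have hnn : ∀ u : Fin n → ℝ, (∀ i, 0 ≤ u i) → ∀ o, 0 ≤ homCoord u o := by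
    rintro u hu (_ | i)
    · exact zero_le_one
    · exact hu i
  have hval : ∀ u : Fin n → ℝ, (∀ i, 0 ≤ u i) → eval (fun i => nthRoot m (u i))
      (∑ i, b i • homCoord X i ^ m - ∑ a, c a • ∏ i, homCoord X i ^ w a i)
      = ∑ i, b i * homCoord u i - ∑ a, c a * geomMean m (w a) (homCoord u) := by
    intro u hu
    rw [eval_diag_sub_tail, hr]
    simp only [nthRoot_pow hm0 (hnn u hu _), geomMean]
  have hlin : homCoord (p • y + q • z) = p • homCoord y + q • homCoord z := by
    ext (_ | i)
    · simp [homCoord, hpq]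
    · simp [homCoord]
  rw [hval y hy, hval z hz, hval (p • y + q • z) fun i =>
    add_nonneg (mul_nonneg hp (hy i)) (mul_nonneg hq (hz i)), hlin]
  have h1 : ∑ i, b i * (p • homCoord y + q • homCoord z) i
      = p * ∑ i, b i * homCoord y i + q * ∑ i, b i * homCoord z i := by
    rw [Finset.mul_sum, Finset.mul_sum, ← Finset.sum_add_distrib]
    exact Finset.sum_congr rfl fun i _ => by
      simp only [Pi.add_apply, Pi.smul_apply, smul_eq_mul]; ring
  have h2 : p * ∑ a, c a * geomMean m (w a) (homCoord y)
      + q * ∑ a, c a * geomMean m (w a) (homCoord z)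
      ≤ ∑ a, c a * geomMean m (w a) (p • homCoord y + q • homCoord z) := by
    rw [Finset.mul_sum, Finset.mul_sum, ← Finset.sum_add_distrib]
    refine Finset.sum_le_sum fun a _ => ?_
    have := mul_le_mul_of_nonneg_left
      (geomMean_concave hm hm0 (w a) (hw a) (hnn y hy) (hnn z hz) hp hq) (hc a)
    linarith
  rw [h1]
  linarith

/-- Lagrange multipliers for a convex-like system satisfying the Slater condition. -/
lemma exists_lagrange_multiplier {Y : Type*} {p : ℕ} (F : Fin (p + 1) → Y → ℝ)
    (hF : ∀ (y z : Y) (s t : ℝ), 0 ≤ s → 0 ≤ t → s + t = 1 →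
      ∃ v, ∀ l, F l v ≤ s * F l y + t * F l z)
    (y₀ : Y) (hy₀ : ∀ l : Fin p, F l.succ y₀ < 0) (μ : ℝ)
    (hμ : ∀ y, (∀ l : Fin p, F l.succ y ≤ 0) → μ ≤ F 0 y) :
    ∃ lam : Fin p → ℝ, (∀ l, 0 ≤ lam l) ∧ ∀ y, μ ≤ F 0 y + ∑ l, lam l * F l.succ y := by
  classical
  set U : Set (Fin (p + 1) → ℝ) := {u | ∃ y, ∀ l, F l y < u l} with hU
  have hUo : IsOpen U := by
    have : U = ⋃ y, Set.univ.pi fun l => Set.Ioi (F l y) := by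
      ext u; simp [hU]
    rw [this]
    exact isOpen_iUnion fun y => isOpen_set_pi Set.finite_univ fun i _ => isOpen_Ioi
  have hUc : Convex ℝ U := by
    rintro u ⟨y, hy⟩ v ⟨z, hz⟩ s t hs ht hst
    obtain ⟨x, hx⟩ := hF y z s t hs ht hst
    refine ⟨x, fun l => (hx l).trans_lt ?_⟩
    change _ < s * u l + t * v l
    rcases hs.eq_or_lt with rfl | hs'
    · have : t = 1 := by linarith
      subst this
      linarith [hz l]
    · nlinarith [mul_lt_mul_of_pos_left (hy l) hs', mul_le_mul_of_nonneg_left (hz l).le ht]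
  have hnot : (Pi.single 0 μ : Fin (p + 1) → ℝ) ∉ U := by
    rintro ⟨y, hy⟩
    have h1 := hμ y fun l => by simpa [Pi.single_apply, Fin.succ_ne_zero] using (hy l.succ).le
    have h2 := hy 0
    rw [Pi.single_eq_same] at h2
    linarith
  obtain ⟨φ, hφ⟩ := geometric_hahn_banach_open_point hUc hUo hnot
  set v : Fin (p + 1) → ℝ := fun l => - φ (Pi.single l 1) with hv
  have hφv : ∀ u : Fin (p + 1) → ℝ, φ u = - ∑ l, u l * v l := by
    intro u
    conv_lhs => rw [← Finset.univ_sum_single u]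
    rw [map_sum, ← Finset.sum_neg_distrib]
    refine Finset.sum_congr rfl fun i _ => ?_
    rw [hv, mul_neg, neg_neg, ← smul_eq_mul, ← map_smul, ← Pi.single_smul, smul_eq_mul, mul_one]
  have hsep : ∀ u ∈ U, μ * v 0 < ∑ l, u l * v l := by
    intro u hu
    have h := hφ u hu
    rw [hφv, hφv] at h
    simp only [Fin.sum_univ_succ, Pi.single_eq_same, Pi.single_eq_of_ne (Fin.succ_ne_zero _),
      zero_mul, Finset.sum_const_zero, add_zero] at h
    rw [Fin.sum_univ_succ]
    linarith
  have hv0 : ∀ l, 0 ≤ v l := by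
    intro i
    by_contra! hneg
    set S := ∑ l, (F l y₀ + 1) * v l with hS
    obtain ⟨k, hk⟩ := exists_nat_gt ((S - μ * v 0) / (- v i))
    rw [div_lt_iff₀ (by linarith)] at hk
    have hmem : (fun l => F l y₀ + 1 + k * (Pi.single i (1 : ℝ) : Fin (p + 1) → ℝ) l) ∈ U := by
      refine ⟨y₀, fun l => ?_⟩
      have : (0 : ℝ) ≤ (k : ℝ) * (Pi.single i (1 : ℝ) : Fin (p + 1) → ℝ) l :=
        mul_nonneg k.cast_nonneg (by by_cases h : l = i <;> simp [h])
      linarith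
    have h1 := hsep _ hmem
    have h2 : ∑ l, (F l y₀ + 1 + k * (Pi.single i (1 : ℝ) : Fin (p + 1) → ℝ) l) * v l
        = S + k * v i := by
      simp only [add_mul _ _ (v _), Finset.sum_add_distrib, hS, mul_assoc, ← Finset.mul_sum]
      simp [Pi.single_apply]
    rw [h2] at h1
    linarith
  have hall : ∀ y, μ * v 0 ≤ ∑ l, F l y * v l := by
    intro y
    refine le_of_forall_pos_le_add fun ε hε => ?_
    have hden : 0 < ∑ l, v l + 1 := by
      have := Finset.sum_nonneg fun l (_ : l ∈ univ) => hv0 l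
      linarith
    set δ := ε / (∑ l, v l + 1) with hδ
    have hδ0 : 0 < δ := div_pos hε hden
    have h1 := hsep (fun l => F l y + δ) ⟨y, fun l => by linarith⟩
    simp only [add_mul, Finset.sum_add_distrib, ← Finset.mul_sum] at h1
    have h2 : δ * (∑ l, v l + 1) = ε := div_mul_cancel₀ _ hden.ne'
    linarith
  have hv0pos : 0 < v 0 := by
    refine lt_of_le_of_ne (hv0 0) fun h0 => ?_
    have h1 := hsep (Fin.cons (F 0 y₀ + 1) 0) ⟨y₀, fun l => by
      refine Fin.cases ?_ (fun j => ?_) l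
      · simp
      · simpa using hy₀ j⟩
    simp [Fin.sum_univ_succ, ← h0] at h1
  refine ⟨fun l => v l.succ / v 0, fun l => div_nonneg (hv0 _) (hv0 0), fun y => ?_⟩
  have h1 := hall y
  rw [Fin.sum_univ_succ] at h1
  have h2 : ∑ l : Fin p, v l.succ / v 0 * F l.succ y = (∑ l : Fin p, F l.succ y * v l.succ) / v 0 := by
    rw [Finset.sum_div]
    exact Finset.sum_congr rfl fun l _ => by ring
  rw [h2, ← mul_le_mul_iff_left₀ hv0pos, add_mul, div_mul_cancel₀ _ hv0pos.ne']
  exact h1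

/-- Exact sum-of-squares relaxation for polynomial optimization with essentially
nonpositive coefficients, under the Slater condition. -/
theorem stmt16 (n m p : ℕ) (hm : Even m)
    (f : Fin (p + 1) → MvPolynomial (Fin n) ℝ)
    (hdeg : ∀ l, (f l).totalDegree ≤ m)
    (hcoeff : ∀ l, EssNonposCoeff m (f l))
    (hslater : ∃ x0 : Fin n → ℝ, ∀ l : Fin p, MvPolynomial.eval x0 (f l.succ) < 0)
    (hbdd : BddBelow {y : ℝ | ∃ x : Fin n → ℝ,
        (∀ l : Fin p, MvPolynomial.eval x (f l.succ) ≤ 0) ∧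
        y = MvPolynomial.eval x (f 0)}) :
    IsGreatest {μ : ℝ | ∃ lam : Fin p → ℝ, (∀ l, 0 ≤ lam l) ∧
        ∃ σ : MvPolynomial (Fin n) ℝ, IsSOSPoly σ ∧ σ.totalDegree ≤ m ∧
          f 0 + (∑ l, lam l • f l.succ) - MvPolynomial.C μ = σ}
      (sInf {y : ℝ | ∃ x : Fin n → ℝ,
        (∀ l : Fin p, MvPolynomial.eval x (f l.succ) ≤ 0) ∧
        y = MvPolynomial.eval x (f 0)}) := by
  obtain ⟨x0, hx0⟩ := hslater
  set V : Set ℝ := {y : ℝ | ∃ x : Fin n → ℝ,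
    (∀ l : Fin p, MvPolynomial.eval x (f l.succ) ≤ 0) ∧ y = MvPolynomial.eval x (f 0)} with hV
  have hne : V.Nonempty := ⟨_, x0, fun l => (hx0 l).le, rfl⟩
  constructor
  · rcases eq_or_ne m 0 with rfl | hm0
    · obtain ⟨a, ha⟩ : ∃ a, f 0 = C a :=
        ⟨_, totalDegree_eq_zero_iff_eq_C.mp (Nat.le_zero.mp (hdeg 0))⟩
      have hVa : V = {a} := by
        ext y
        simp only [hV, ha, eval_C, Set.mem_ofPred_eq, Set.mem_singleton_iff]
        exact ⟨fun ⟨_, _, h⟩ => h, fun h => ⟨x0, fun l => (hx0 l).le, h⟩⟩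
      refine ⟨0, fun _ => le_rfl, 0, IsSumSq.zero.isSOSPoly, by simp, ?_⟩
      simp [hVa, ha]
    · obtain ⟨lam, hlam, hL⟩ := exists_lagrange_multiplier
        (Y := {y : Fin n → ℝ // ∀ i, 0 ≤ y i})
        (fun l y => eval (fun i => nthRoot m (y.1 i)) (f l))
        (fun y z s t hs ht hst => ⟨⟨s • y.1 + t • z.1, fun i =>
          add_nonneg (mul_nonneg hs (y.2 i)) (mul_nonneg ht (z.2 i))⟩, fun l =>
          (hcoeff l).eval_nthRoot_convex hm hm0 (hdeg l) y.2 z.2 hs ht hst⟩)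
        ⟨fun i => |x0 i| ^ m, fun i => by positivity⟩
        (fun l => by
          simp only [nthRoot_pow' hm0 (abs_nonneg _)]
          exact ((hcoeff _).eval_abs_le hm hm0 (hdeg _) x0).trans_lt (hx0 l))
        (sInf V) (fun y hy => csInf_le hbdd ⟨_, hy, rfl⟩)
      have hdegσ : (f 0 + (∑ l, lam l • f l.succ) - C (sInf V)).totalDegree ≤ m := by
        refine (totalDegree_sub_C_le _ _).trans ((totalDegree_add _ _).trans (max_le (hdeg 0) ?_))
        exact totalDegree_finsetSum_le fun l _ =>
          (totalDegree_smul_le _ _).trans (hdeg _)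
      refine ⟨lam, hlam, _, IsSumSq.isSOSPoly ?_, hdegσ, rfl⟩
      refine EssNonposCoeff.isSumSq hm hm0 hdegσ (fun α hα hαi => ?_) (fun x hx => ?_)
      · simp only [coeff_sub, coeff_add, coeff_sum, coeff_smul, smul_eq_mul, coeff_C, hα.symm,
          if_false, sub_zero]
        exact add_nonpos (hcoeff 0 α hα hαi) (Finset.sum_nonpos fun l _ =>
          mul_nonpos_of_nonneg_of_nonpos (hlam l) (hcoeff _ α hα hαi))
      · have h1 := hL ⟨fun i => x i ^ m, fun i => (pow_pos (hx i) m).le⟩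
        simp only [nthRoot_pow' hm0 (hx _).le] at h1
        simp only [map_sub, map_add, map_sum, smul_eval, eval_C]
        linarith
  · rintro μ ⟨lam, hlam, σ, ⟨r, g, rfl⟩, -, heq⟩
    refine le_csInf hne ?_
    rintro _ ⟨x, hx, rfl⟩
    have h1 := congrArg (eval x) heq
    simp only [map_sub, map_add, map_sum, smul_eval, eval_C, map_pow] at h1
    have h2 : 0 ≤ ∑ j, eval x (g j) ^ 2 := Finset.sum_nonneg fun j _ => sq_nonneg _
    have h3 : ∑ l, lam l * eval x (f l.succ) ≤ 0 := Finset.sum_nonpos fun l _ =>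
      mul_nonpos_of_nonneg_of_nonpos (hlam l) (hx l)
    linarith
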